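/- The random walk on A_n driven by P′ exhibits the total variation cutoff phenomenon at time (1/2)(n−1)·log n with window of order n: lim_{c→∞} limsup_{n→∞} ‖(P′)^{*⌈(1/2)(n−1)·log n + c·n⌉} − U_{A_n}‖_TV = 0 and lim_{c→−∞} liminf_{n→∞} ‖(P′)^{*⌈(1/2)(n−1)·log n + c·n⌉} − U_{A_n}‖_TV = 1. -/

import Mathlib

open scoped Classical
open Filter

noncomputable def convolve {G : Type*} [Group G] [Fintype G] (α β : G → ℝ) : G → ℝ :=
  fun x => ∑ g : G, α g * β (g⁻¹ * x)

noncomputable def convPow {G : Type*} [Group G] [Fintype G] (γ : G → ℝ) : ℕ → G → ℝ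
  | 0 => fun x => if x = 1 then 1 else 0
  | k + 1 => convolve (convPow γ k) γ

noncomputable def tvDist {Ω : Type*} [Fintype Ω] (p q : Ω → ℝ) : ℝ :=
  (∑ ω : Ω, |p ω - q ω|) / 2

noncomputable def unif (Ω : Type*) [Fintype Ω] : Ω → ℝ := fun _ => 1 / (Fintype.card Ω)

/-- The transpose top-2 with random shuffle measure on `A_n`: mass `1/(2n-3)` on the
identity and on each 3-cycle of the form `(i, n-1, n)` or `(i, n, n-1)` with
`1 ≤ i ≤ n-2`; these 3-cycles are exactly the 3-cycles whose support contains both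
of the two largest points. -/
noncomputable def Pmeas (n : ℕ) : alternatingGroup (Fin n) → ℝ := fun π =>
  if (π : Equiv.Perm (Fin n)) = 1 then 1 / (2 * (n : ℝ) - 3)
  else if (π : Equiv.Perm (Fin n)).IsThreeCycle ∧
      (∀ x : Fin n, n - 2 ≤ (x : ℕ) → x ∈ (π : Equiv.Perm (Fin n)).support) then
    1 / (2 * (n : ℝ) - 3)
  else 0

/-- The measure `P'` on `A_n`: mass `1/(n-1)` on the identity and `1/(n-1)^2` on each
3-cycle of the form `(i,j,n)` or `(j,i,n)` with `1 ≤ i < j ≤ n-1`; these are exactly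
the 3-cycles whose support contains the largest point. -/
noncomputable def P'meas (n : ℕ) : alternatingGroup (Fin n) → ℝ := fun π =>
  if (π : Equiv.Perm (Fin n)) = 1 then 1 / ((n : ℝ) - 1)
  else if (π : Equiv.Perm (Fin n)).IsThreeCycle ∧
      (∀ x : Fin n, (x : ℕ) = n - 1 → x ∈ (π : Equiv.Perm (Fin n)).support) then
    1 / ((n : ℝ) - 1) ^ 2
  else 0

/-- The measure `Q` on `A_n` giving mass `3/(n(n-1)(n-2))` to every 3-cycle. -/
noncomputable def Qmeas (n : ℕ) : alternatingGroup (Fin n) → ℝ := fun π =>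
  if (π : Equiv.Perm (Fin n)).IsThreeCycle then
    3 / ((n : ℝ) * ((n : ℝ) - 1) * ((n : ℝ) - 2))
  else 0

/-! Part 1: eigenvalues of Jucys-Murphy elements. -/

lemma conj_swap {α : Type*} [DecidableEq α] (a b x y : α) :
    Equiv.swap a b * Equiv.swap x y * Equiv.swap a b
      = Equiv.swap (Equiv.swap a b x) (Equiv.swap a b y) := by
  rw [Equiv.swap_apply_apply, Equiv.swap_inv]

noncomputable def JM {n : ℕ} {V : Type*} [AddCommGroup V] [Module ℝ V]
    (ρ : Equiv.Perm (Fin n) →* (V →ₗ[ℝ] V)) (p : Fin n) : V →ₗ[ℝ] V :=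
  ∑ i ∈ Finset.univ.filter (fun i : Fin n => i < p), ρ (Equiv.swap i p)

lemma JM_apply {n : ℕ} {V : Type*} [AddCommGroup V] [Module ℝ V]
    (ρ : Equiv.Perm (Fin n) →* (V →ₗ[ℝ] V)) (p : Fin n) (v : V) :
    JM ρ p v = ∑ i ∈ Finset.univ.filter (fun i : Fin n => i < p), ρ (Equiv.swap i p) v := by
  simp [JM, LinearMap.sum_apply]

lemma rho_mul_apply {n : ℕ} {V : Type*} [AddCommGroup V] [Module ℝ V]
    (ρ : Equiv.Perm (Fin n) →* (V →ₗ[ℝ] V)) (g h : Equiv.Perm (Fin n)) (v : V) :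
    ρ (g * h) v = ρ g (ρ h v) := by
  rw [map_mul]; rfl

/-- `J_q` commutes with permutations fixing every point `≥ q`. -/
lemma JM_comm {n : ℕ} {V : Type*} [AddCommGroup V] [Module ℝ V]
    (ρ : Equiv.Perm (Fin n) →* (V →ₗ[ℝ] V)) (q : Fin n) (g : Equiv.Perm (Fin n))
    (hg : ∀ x, q ≤ x → g x = x) (v : V) :
    JM ρ q (ρ g v) = ρ g (JM ρ q v) := by
  have hlt : ∀ i, i < q → g i < q := by
    intro i hi
    by_contra h
    have h1 := hg (g i) (not_lt.mp h)
    have h2 : g i = i := g.injective h1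
    rw [h2] at h
    exact h hi
  have hlt' : ∀ i, i < q → g⁻¹ i < q := by
    intro i hi
    by_contra h
    have h1 := hg (g⁻¹ i) (not_lt.mp h)
    rw [show g (g⁻¹ i) = i from g.apply_symm_apply i] at h1
    rw [← h1] at h
    exact h hi
  rw [JM_apply, JM_apply, map_sum]
  refine Finset.sum_nbij' (fun i => g⁻¹ i) (fun i => g i) ?_ ?_ ?_ ?_ ?_
  · intro i hi
    simpa using hlt' i (by simpa using hi)
  · intro i hi
    simpa using hlt i (by simpa using hi)
  · intro i _; simp
  · intro i _; simp
  · intro i hi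
    rw [← rho_mul_apply, ← rho_mul_apply]
    congr 2
    rw [Equiv.mul_swap_eq_swap_mul]
    simp [hg q le_rfl]

lemma JM_succ {n : ℕ} {V : Type*} [AddCommGroup V] [Module ℝ V]
    (ρ : Equiv.Perm (Fin n) →* (V →ₗ[ℝ] V)) (p q : Fin n) (hpq : (q : ℕ) = p + 1) (v : V) :
    JM ρ p (ρ (Equiv.swap p q) v) = ρ (Equiv.swap p q) (JM ρ q v) - v := by
  have hne : p ≠ q := by intro h; rw [h] at hpq; omega
  have hset : Finset.univ.filter (fun i : Fin n => i < q)
      = insert p (Finset.univ.filter (fun i : Fin n => i < p)) := by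
    ext i
    simp only [Finset.mem_filter, Finset.mem_univ, true_and, Finset.mem_insert, Fin.lt_def,
      Fin.ext_iff]
    omega
  rw [JM_apply, JM_apply, hset, Finset.sum_insert (by simp), map_add, map_sum,
    ← rho_mul_apply ρ (Equiv.swap p q) (Equiv.swap p q)]
  simp only [Equiv.swap_mul_self, map_one, Module.End.one_apply, add_sub_cancel_left]
  refine Finset.sum_congr rfl fun i hi => ?_
  have hi' : i < p := by simpa using hi
  rw [← rho_mul_apply, ← rho_mul_apply]
  congr 2
  have h1 : i ≠ p := hi'.ne
  have h2 : i ≠ q := by intro h; rw [h] at hi'; rw [Fin.lt_def] at hi'; omega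
  have h3 := conj_swap p q i q
  rw [Equiv.swap_apply_of_ne_of_ne h1 h2, Equiv.swap_apply_right] at h3
  rw [← h3, mul_assoc, Equiv.swap_mul_self, mul_one]

lemma stab_of_star {n : ℕ} {V : Type*} [AddCommGroup V] [Module ℝ V]
    (ρ : Equiv.Perm (Fin n) →* (V →ₗ[ℝ] V)) (q : Fin n) (v : V)
    (hv : ∀ i, i < q → ρ (Equiv.swap i q) v = v) :
    ∀ (k : ℕ) (g : Equiv.Perm (Fin n)), g.support.card = k → (∀ x, q < x → g x = x) →
      ρ g v = v := by
  have hsw : ∀ i j, i ≤ q → j ≤ q → ρ (Equiv.swap i j) v = v := by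
    have h0 : ∀ i, i ≤ q → ρ (Equiv.swap i q) v = v := by
      intro i hi
      rcases hi.lt_or_eq with h | h
      · exact hv i h
      · subst h; rw [Equiv.swap_self]; exact congrArg (fun f => f v) (map_one ρ)
    intro i j hi hj
    by_cases hij : i = j
    · subst hij; rw [Equiv.swap_self]; exact congrArg (fun f => f v) (map_one ρ)
    by_cases hiq : i = q
    · subst hiq; rw [Equiv.swap_comm]; exact h0 j hj
    have : Equiv.swap i j = Equiv.swap j q * Equiv.swap i q * Equiv.swap j q := by
      rw [conj_swap, Equiv.swap_apply_right, Equiv.swap_apply_of_ne_of_ne hij hiq]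
    rw [this, rho_mul_apply, rho_mul_apply, h0 j hj, h0 i hi, h0 j hj]
  intro k
  induction k using Nat.strong_induction_on with
  | _ k ih =>
    intro g hgk hg
    by_cases h1 : g = 1
    · subst h1; simp
    obtain ⟨x, hx⟩ : ∃ x, g x ≠ x := by
      by_contra h; push Not at h; exact h1 (Equiv.ext h)
    have hxq : x ≤ q := by
      by_contra h; exact hx (hg x (not_le.mp h))
    have hgxq : g x ≤ q := by
      by_contra h; exact hx (g.injective (hg (g x) (not_le.mp h)))
    have hlt := Equiv.Perm.card_support_swap_mul hx
    have h2 := ih _ (hgk ▸ hlt) (Equiv.swap x (g x) * g) rfl (by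
      intro y hy
      rw [Equiv.Perm.mul_apply, hg y hy, Equiv.swap_apply_of_ne_of_ne]
      · intro h; rw [h] at hy; exact absurd hy (not_lt.mpr hxq)
      · intro h; rw [h] at hy; exact absurd hy (not_lt.mpr hgxq))
    have h3 : g = Equiv.swap x (g x) * (Equiv.swap x (g x) * g) := by
      rw [← mul_assoc, Equiv.swap_mul_self, one_mul]
    rw [h3, rho_mul_apply, h2, hsw _ _ hxq hgxq]

theorem JM_eigen {n : ℕ} {V : Type*} [AddCommGroup V] [Module ℝ V] [FiniteDimensional ℝ V]
    (ρ : Equiv.Perm (Fin n) →* (V →ₗ[ℝ] V)) (m : ℕ) (hm : 2 ≤ m)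
    (hinv : ∀ v : V, (∀ g : Equiv.Perm (Fin n), (∀ x : Fin n, m ≤ (x : ℕ) → g x = x) →
      ρ g v = v) → v = 0) :
    ∀ (p : ℕ) (hp : p < n) (a : ℝ) (v : V), min (p : ℝ) ((m : ℝ) - 2) < a →
      JM ρ ⟨p, hp⟩ v = a • v → v = 0 := by
  intro p
  have hm' : (2 : ℝ) ≤ m := by exact_mod_cast hm
  induction p with
  | zero =>
    intro hp a v ha hv
    have h0 : JM ρ ⟨0, hp⟩ v = 0 := by
      rw [JM_apply]
      apply Finset.sum_eq_zero
      intro i hi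
      simp [Fin.lt_def] at hi
    rw [h0] at hv
    have : a ≠ 0 := by
      have : min ((0 : ℕ) : ℝ) ((m : ℝ) - 2) = 0 := by
        simp; linarith
      rw [this] at ha; exact ha.ne'
    have := smul_eq_zero.mp hv.symm
    tauto
  | succ p ih =>
    intro hq a v ha hv
    have hp : p < n := by omega
    set P : Fin n := ⟨p, hp⟩ with hP
    set Q : Fin n := ⟨p + 1, hq⟩ with hQ
    have hap : min (p : ℝ) ((m : ℝ) - 2) < a := by
      refine lt_of_le_of_lt ?_ ha
      apply min_le_min_right
      push_cast; linarith
    set s := Equiv.swap P Q with hs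
    have hPQ : (Q : ℕ) = P + 1 := rfl
    -- the eigenspace
    let E : Submodule ℝ V := Module.End.eigenspace (JM ρ Q) a
    have hE : ∀ w, w ∈ E ↔ JM ρ Q w = a • w := fun w => Module.End.mem_eigenspace_iff
    have hstab : ∀ g : Equiv.Perm (Fin n), (∀ x, Q ≤ x → g x = x) → ∀ w ∈ E, ρ g w ∈ E := by
      intro g hg w hw
      rw [hE] at *
      rw [JM_comm ρ Q g hg, hw, map_smul]
    have hJP : ∀ w ∈ E, JM ρ P w ∈ E := by
      intro w hw
      rw [JM_apply]
      refine Submodule.sum_mem _ fun i hi => hstab _ ?_ w hw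
      intro x hx
      have hi' : i < P := by simpa using hi
      have hPlt : P < Q := by simp [Fin.lt_def, hPQ]
      apply Equiv.swap_apply_of_ne_of_ne
      · exact (lt_of_lt_of_le (hi'.trans hPlt) hx).ne'
      · exact (lt_of_lt_of_le hPlt hx).ne'
    -- B = a - J_p
    let B : V →ₗ[ℝ] V := a • LinearMap.id - JM ρ P
    have hBapp : ∀ w, B w = a • w - JM ρ P w := fun w => by simp [B]
    have hBinj : Function.Injective B := by
      rw [injective_iff_map_eq_zero]
      intro w hw
      rw [hBapp, sub_eq_zero] at hw
      exact ih hp a w hap hw.symm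
    have hBE : ∀ w ∈ E, B w ∈ E := by
      intro w hw
      rw [hBapp]
      exact E.sub_mem (E.smul_mem _ hw) (hJP w hw)
    have hBs : ∀ w ∈ E, B (ρ s w) = w := by
      intro w hw
      rw [hBapp, JM_succ ρ P Q hPQ, (hE w).mp hw, map_smul]
      abel
    have hsE : ∀ w ∈ E, ρ s w ∈ E := by
      intro w hw
      have hinj : Function.Injective (B.restrict hBE) := by
        intro x y hxy
        have := congrArg Subtype.val hxy
        simp only [LinearMap.coe_restrict_apply] at this
        exact Subtype.ext (hBinj this)
      obtain ⟨u, hu⟩ := LinearMap.surjective_of_injective hinj ⟨w, hw⟩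
      have hu' : B u.1 = w := by
        have := congrArg Subtype.val hu
        simpa using this
      have : ρ s w = u.1 := hBinj (by rw [hBs w hw, hu'])
      rw [this]; exact u.2
    have hss : ∀ w, ρ s (ρ s w) = w := by
      intro w; rw [← rho_mul_apply, hs, Equiv.swap_mul_self]; simp
    have hsfix : ∀ w ∈ E, ρ s w = w := by
      intro w hw
      have hu : ρ s w - w ∈ E := E.sub_mem (hsE w hw) hw
      have hsu : ρ s (ρ s w - w) = -(ρ s w - w) := by
        rw [map_sub, hss]; abel
      have h1 := hBs _ hu
      rw [hsu, map_neg, hBapp] at h1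
      have h2 : JM ρ P (ρ s w - w) = (a + 1) • (ρ s w - w) := by
        rw [add_smul, one_smul]
        have : JM ρ P (ρ s w - w) = -(a • (ρ s w - w) - JM ρ P (ρ s w - w))
          + a • (ρ s w - w) := by abel
        rw [this, h1]; abel
      have h3 := ih hp (a + 1) _ (by linarith) h2
      exact sub_eq_zero.mp h3
    have hvE : v ∈ E := (hE v).mpr hv
    have hstar : ∀ i, i < Q → ρ (Equiv.swap i Q) v = v := by
      intro i hi
      by_cases hiP : i = P
      · rw [hiP]; exact hsfix v hvE
      have hiP' : i < P := by
        simp only [Fin.lt_def, Fin.ext_iff] at *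
        omega
      have hPlt : P < Q := by simp [Fin.lt_def, hPQ]
      have hgfix : ∀ x, Q ≤ x → Equiv.swap i P x = x := by
        intro x hx
        apply Equiv.swap_apply_of_ne_of_ne
        · exact (lt_of_lt_of_le (hiP'.trans hPlt) hx).ne'
        · exact (lt_of_lt_of_le hPlt hx).ne'
      have hconj : Equiv.swap i Q = Equiv.swap i P * s * Equiv.swap i P := by
        rw [hs, conj_swap, Equiv.swap_apply_right, hgfix Q le_rfl]
      rw [hconj, rho_mul_apply, rho_mul_apply, hsfix _ (hstab _ hgfix v hvE),
        ← rho_mul_apply, Equiv.swap_mul_self]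
      simp
    have hJv : JM ρ Q v = ((p + 1 : ℕ) : ℝ) • v := by
      rw [JM_apply, Finset.sum_congr rfl (fun i hi => hstar i (by simpa using hi))]
      rw [Finset.sum_const]
      have : (Finset.univ.filter (fun i : Fin n => i < Q)).card = p + 1 := by
        have : (Finset.univ.filter (fun i : Fin n => i < Q)) = Finset.Iio Q := by
          ext; simp
        rw [this, Fin.card_Iio]
      rw [this, Nat.cast_smul_eq_nsmul]
    by_contra hv0
    have haq : a = ((p + 1 : ℕ) : ℝ) := by
      have : (a - ((p + 1 : ℕ) : ℝ)) • v = 0 := by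
        rw [sub_smul, ← hv, hJv, sub_self]
      rcases smul_eq_zero.mp this with h | h
      · linarith
      · exact absurd h hv0
    have hmq : m ≤ p + 2 := by
      by_contra h
      push Not at h
      have : ((p + 1 : ℕ) : ℝ) ≤ (m : ℝ) - 2 := by
        have : ((p + 3 : ℕ) : ℝ) ≤ m := by exact_mod_cast h
        push_cast at *; linarith
      rw [min_eq_left this, haq] at ha
      exact lt_irrefl _ ha
    apply hv0
    apply hinv
    intro g hg
    refine stab_of_star ρ Q v hstar _ g rfl ?_
    intro x hx
    apply hg
    have : p + 1 < (x : ℕ) := hx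
    omega

/-! Part 2: the star transposition matrix and its spectrum. -/

/-- Right regular representation on functions. -/
noncomputable def rreg (n : ℕ) :
    Representation ℝ (Equiv.Perm (Fin n)) (Equiv.Perm (Fin n) → ℝ) where
  toFun g := { toFun := fun f x => f (x * g), map_add' := fun _ _ => rfl,
               map_smul' := fun _ _ => rfl }
  map_one' := by ext f x; simp
  map_mul' g h := by
    apply LinearMap.ext; intro f; funext x
    simp [mul_assoc]

lemma rreg_apply (n : ℕ) (g : Equiv.Perm (Fin n)) (f : Equiv.Perm (Fin n) → ℝ)
    (x : Equiv.Perm (Fin n)) : rreg n g f x = f (x * g) := rfl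

noncomputable def phiInd (n j : ℕ) (t : Σ B : {B : Finset (Fin n) // B.card = j}, (B.1 → Fin n)) :
    Equiv.Perm (Fin n) → ℝ :=
  fun x => if ∀ b : t.1.1, x b = t.2 b then 1 else 0

noncomputable def Flev (n j : ℕ) : Submodule ℝ (Equiv.Perm (Fin n) → ℝ) :=
  Submodule.span ℝ (Set.range (phiInd n j))

lemma Flev_finrank (n j : ℕ) : Module.finrank ℝ (Flev n j) ≤ n.choose j * n ^ j := by
  refine (finrank_range_le_card (R := ℝ) (phiInd n j)).trans ?_
  rw [Fintype.card_sigma]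
  have : ∀ B : {B : Finset (Fin n) // B.card = j}, Fintype.card (B.1 → Fin n) = n ^ j := by
    intro B
    rw [Fintype.card_fun]
    simp [B.2]
  rw [Finset.sum_congr rfl (fun B _ => this B)]
  simp

lemma dep_mem (n j : ℕ) (B : Finset (Fin n)) (hB : B.card = j) (f : Equiv.Perm (Fin n) → ℝ)
    (hf : ∀ x y : Equiv.Perm (Fin n), (∀ b ∈ B, x b = y b) → f x = f y) : f ∈ Flev n j := by
  let c : (B → Fin n) → ℝ := fun z =>
    if h : ∃ x : Equiv.Perm (Fin n), ∀ b : B, x b = z b then f h.choose else 0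
  have : f = ∑ z : B → Fin n, c z • phiInd n j ⟨⟨B, hB⟩, z⟩ := by
    funext x
    rw [Finset.sum_apply, Finset.sum_eq_single (fun b : B => x b)]
    · have h : ∃ y : Equiv.Perm (Fin n), ∀ b : B, y b = (fun b : B => x b) b := ⟨x, fun _ => rfl⟩
      have hc : c (fun b : B => x b) = f h.choose := dif_pos h
      have h2 := h.choose_spec
      simp only [Pi.smul_apply, phiInd, smul_eq_mul]
      rw [if_pos (fun _ => trivial), mul_one, hc]
      exact hf _ _ (fun b hb => (h2 ⟨b, hb⟩).symm)
    · intro z _ hz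
      simp only [Pi.smul_apply, phiInd, smul_eq_mul]
      rw [if_neg, mul_zero]
      intro h
      exact hz (funext fun b => (h b).symm)
    · intro h; exact absurd (Finset.mem_univ _) h
  rw [this]
  exact Submodule.sum_mem _ fun z _ => Submodule.smul_mem _ _ (Submodule.subset_span ⟨_, rfl⟩)

lemma Flev_stable (n j : ℕ) (g : Equiv.Perm (Fin n)) : Flev n j ≤ (Flev n j).comap (rreg n g) := by
  rw [Flev, Submodule.span_le]
  rintro _ ⟨⟨⟨B, hB⟩, z⟩, rfl⟩
  refine dep_mem n j (B.map g.toEmbedding) (by simpa using hB) _ ?_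
  intro x y hxy
  simp only [rreg_apply, phiInd]
  have : ∀ b : B, (x * g) b = (y * g) b := by
    intro b
    exact hxy (g b) (by simp)
  simp only [this]

lemma inv_mem (n j : ℕ) (hj : j ≤ n) (f : Equiv.Perm (Fin n) → ℝ)
    (hf : ∀ g : Equiv.Perm (Fin n), (∀ x : Fin n, n - j ≤ (x : ℕ) → g x = x) →
      rreg n g f - f ∈ Flev n j) : f ∈ Flev n j := by
  let H : Finset (Equiv.Perm (Fin n)) :=
    Finset.univ.filter (fun g => ∀ x : Fin n, n - j ≤ (x : ℕ) → g x = x)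
  have hH : ∀ g, g ∈ H ↔ ∀ x : Fin n, n - j ≤ (x : ℕ) → g x = x := by intro g; simp [H]
  let B : Finset (Fin n) := Finset.univ.filter (fun x : Fin n => n - j ≤ (x : ℕ))
  have hB : B.card = j := by
    have h1 : B = (Finset.univ.filter (fun x : Fin n => (x : ℕ) < n - j))ᶜ := by
      ext x; simp [B]
    rw [h1, Finset.card_compl, Fin.card_filter_val_lt]
    simp; omega
  have h1 : (∑ g ∈ H, rreg n g f) ∈ Flev n j := by
    refine dep_mem n j B hB _ ?_
    intro x y hxy
    simp only [Finset.sum_apply, rreg_apply]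
    have hxyH : ∀ b : Fin n, n - j ≤ (b : ℕ) → x b = y b := fun b hb => hxy b (by simpa [B] using hb)
    have k1 : ∀ b : Fin n, n - j ≤ (b : ℕ) → (y⁻¹ * x) b = b := by
      intro b hb
      rw [Equiv.Perm.mul_apply, hxyH b hb]
      exact y.symm_apply_apply b
    have k2 : ∀ b : Fin n, n - j ≤ (b : ℕ) → (x⁻¹ * y) b = b := by
      intro b hb
      rw [Equiv.Perm.mul_apply, ← hxyH b hb]
      exact x.symm_apply_apply b
    refine Finset.sum_nbij' (fun g => y⁻¹ * x * g) (fun g => x⁻¹ * y * g) ?_ ?_ ?_ ?_ ?_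
    · intro g hg
      rw [hH] at *
      intro b hb
      rw [Equiv.Perm.mul_apply, hg b hb, k1 b hb]
    · intro g hg
      rw [hH] at *
      intro b hb
      rw [Equiv.Perm.mul_apply, hg b hb, k2 b hb]
    · intro g _; group
    · intro g _; group
    · intro g _; congr 1; group
  have h2 : (∑ g ∈ H, (rreg n g f - f)) ∈ Flev n j :=
    Submodule.sum_mem _ fun g hg => hf g ((hH g).mp hg)
  have h3 : (H.card : ℝ) • f ∈ Flev n j := by
    have := Submodule.sub_mem _ h1 h2
    rwa [Finset.sum_sub_distrib, sub_sub_cancel, Finset.sum_const, ← Nat.cast_smul_eq_nsmul ℝ]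
      at this
  have h4 : (H.card : ℝ) ≠ 0 := by
    have : (1 : Equiv.Perm (Fin n)) ∈ H := by rw [hH]; intros; rfl
    exact_mod_cast (Finset.card_pos.mpr ⟨_, this⟩).ne'
  have := Submodule.smul_mem _ ((H.card : ℝ)⁻¹) h3
  rwa [smul_smul, inv_mul_cancel₀ h4, one_smul] at this

/-- star transposition -/
noncomputable def star' {N : ℕ} (i : Fin N) : Equiv.Perm (Fin (N + 1)) :=
  Equiv.swap i.castSucc (Fin.last N)

lemma JM_last {N : ℕ} (f : Equiv.Perm (Fin (N + 1)) → ℝ) (x) :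
    JM (rreg (N + 1)) (Fin.last N) f x = ∑ i : Fin N, f (x * star' i) := by
  rw [JM_apply, Finset.sum_apply, Finset.sum_filter, Fin.sum_univ_castSucc]
  simp [rreg_apply, star', Fin.castSucc_lt_last]

lemma eig_mem {N : ℕ} (j : ℕ) (hj : j + 1 ≤ N) (a : ℝ) (ha : (N : ℝ) - 1 - j < a)
    (f : Equiv.Perm (Fin (N + 1)) → ℝ) (hf : ∀ x, ∑ i : Fin N, f (x * star' i) = a * f x) :
    f ∈ Flev (N + 1) j := by
  let W := Flev (N + 1) j
  let ρ : Representation ℝ _ _ := (rreg (N + 1)).quotient W (Flev_stable (N + 1) j)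
  have hρ : ∀ g h, ρ g (W.mkQ h) = W.mkQ (rreg (N + 1) g h) := fun g h => rfl
  have hinv : ∀ v : (_ ⧸ W), (∀ g : Equiv.Perm (Fin (N + 1)),
      (∀ x : Fin (N + 1), N + 1 - j ≤ (x : ℕ) → g x = x) → ρ g v = v) → v = 0 := by
    intro v hv
    obtain ⟨h, rfl⟩ := W.mkQ_surjective v
    rw [Submodule.mkQ_apply, Submodule.Quotient.mk_eq_zero]
    apply inv_mem _ _ (by omega)
    intro g hg
    have := hv g hg
    rw [hρ, ← sub_eq_zero, ← map_sub, Submodule.mkQ_apply, Submodule.Quotient.mk_eq_zero] at this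
    exact this
  have key := JM_eigen ρ (N + 1 - j) (by omega) hinv N (by omega) a (W.mkQ f) (by
    refine lt_of_le_of_lt (min_le_right _ _) ?_
    rw [Nat.cast_sub (by omega)]; push_cast; linarith) (by
    rw [JM_apply]
    simp only [hρ]
    rw [← map_sum, ← JM_apply, ← map_smul]
    congr 1
    funext x
    have := JM_last f x
    rw [Pi.smul_apply, smul_eq_mul, ← hf x]
    exact this)
  rwa [Submodule.mkQ_apply, Submodule.Quotient.mk_eq_zero] at key

lemma exists_spectral {G : Type*} [Fintype G] [DecidableEq G] (A : Matrix G G ℝ)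
    (hA : A.IsHermitian) : ∃ (μ : G → ℝ) (v : G → G → ℝ), LinearIndependent ℝ v ∧
      (∀ i, A.mulVec (v i) = μ i • v i) ∧ ∀ r : ℕ, (A ^ r).trace = ∑ i, μ i ^ r := by
  refine ⟨hA.eigenvalues, fun i => (hA.eigenvectorBasis i).ofLp, ?_, ?_, ?_⟩
  · have := hA.eigenvectorBasis.orthonormal.linearIndependent
    exact this.map' (WithLp.linearEquiv 2 ℝ (G → ℝ)).toLinearMap
      (LinearEquiv.ker _)
  · intro i
    exact hA.mulVec_eigenvectorBasis i
  · intro r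
    conv_lhs => rw [hA.spectral_theorem]
    rw [← map_pow, Unitary.conjStarAlgAut_apply, Matrix.trace_mul_cycle, Matrix.diagonal_pow]
    simp [Matrix.trace_diagonal]

/-! Part 3: return probability bound. -/

noncomputable def starM (N : ℕ) :
    Matrix (Equiv.Perm (Fin (N + 1))) (Equiv.Perm (Fin (N + 1))) ℝ :=
  fun x y => ∑ i : Fin N, if y = x * star' i then 1 else 0

lemma star'_mul_self {N : ℕ} (i : Fin N) : star' i * star' i = 1 := Equiv.swap_mul_self _ _

lemma starM_mulVec (N : ℕ) (f : Equiv.Perm (Fin (N + 1)) → ℝ) (x) :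
    (starM N).mulVec f x = ∑ i : Fin N, f (x * star' i) := by
  simp only [Matrix.mulVec, dotProduct, starM, Finset.sum_mul]
  rw [Finset.sum_comm]
  refine Finset.sum_congr rfl fun i _ => ?_
  simp

lemma starM_herm (N : ℕ) : (starM N).IsHermitian := by
  ext x y
  simp only [Matrix.conjTranspose_apply, starM, star_trivial]
  refine Finset.sum_congr rfl fun i _ => ?_
  congr 1
  apply propext
  constructor
  · intro h; rw [h, mul_assoc, star'_mul_self, mul_one]
  · intro h; rw [h, mul_assoc, star'_mul_self, mul_one]

lemma count_le {G : Type*} [Fintype G] (v : G → G → ℝ) (hv : LinearIndependent ℝ v)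
    (Φ : (G → ℝ) →ₗ[ℝ] (G → ℝ)) (hΦ : Function.Injective Φ) (F : Submodule ℝ (G → ℝ))
    (I : Finset G) (hI : ∀ i ∈ I, Φ (v i) ∈ F) : I.card ≤ Module.finrank ℝ F := by
  have h1 : LinearIndependent ℝ (fun i : I => Φ (v i)) :=
    (hv.map' Φ (LinearMap.ker_eq_bot.mpr hΦ)).comp _ Subtype.val_injective
  let w : I → F := fun i => ⟨Φ (v i), hI i i.2⟩
  have h2 : LinearIndependent ℝ w := LinearIndependent.of_comp F.subtype h1
  have := h2.fintype_card_le_finrank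
  simpa using this

lemma sum_pow_bound {G : Type*} [Fintype G] (N : ℕ) (μ : G → ℝ) (D : ℕ → ℝ)
    (hμ : ∀ i, |μ i| ≤ N)
    (h1 : ∀ j < N, ((Finset.univ.filter (fun i => (N : ℝ) - 1 - j < μ i)).card : ℝ) ≤ D j)
    (h2 : ∀ j < N, ((Finset.univ.filter (fun i => (N : ℝ) - 1 - j < -μ i)).card : ℝ) ≤ D j)
    (r : ℕ) (hr : Even r) (hr0 : r ≠ 0) :
    ∑ i, μ i ^ r ≤ 2 * ∑ j ∈ Finset.range N, D j * ((N : ℝ) - j) ^ r := by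
  have hterm : ∀ i, μ i ^ r ≤ ∑ j ∈ Finset.range N,
      ((if (N : ℝ) - 1 - j < μ i then (1 : ℝ) else 0) +
        (if (N : ℝ) - 1 - j < -μ i then (1 : ℝ) else 0)) * ((N : ℝ) - j) ^ r := by
    intro i
    have hnn : ∀ j ∈ Finset.range N, 0 ≤ ((if (N : ℝ) - 1 - j < μ i then (1 : ℝ) else 0) +
        (if (N : ℝ) - 1 - j < -μ i then (1 : ℝ) else 0)) * ((N : ℝ) - j) ^ r := by
      intro j _
      apply mul_nonneg
      · split_ifs <;> norm_num
      · exact hr.pow_nonneg _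
    by_cases h0 : μ i = 0
    · rw [h0, zero_pow hr0]
      rw [h0] at hnn
      exact Finset.sum_nonneg hnn
    have hpos : 0 < |μ i| := abs_pos.mpr h0
    set c := ⌈|μ i|⌉₊ with hc
    have hc0 : 0 < c := Nat.ceil_pos.mpr hpos
    have hcN : c ≤ N := Nat.ceil_le.mpr (hμ i)
    have hjmem : N - c ∈ Finset.range N := by simp; omega
    refine le_trans ?_ (Finset.single_le_sum hnn hjmem)
    have hcast : ((N - c : ℕ) : ℝ) = (N : ℝ) - c := by rw [Nat.cast_sub hcN]
    rw [hcast]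
    have hlt : (c : ℝ) < |μ i| + 1 := Nat.ceil_lt_add_one hpos.le
    have hle : |μ i| ≤ c := Nat.le_ceil _
    have e1 : (N : ℝ) - (N - c) = c := by ring
    have e2 : (N : ℝ) - 1 - (N - c) = c - 1 := by ring
    rw [e1, e2]
    have hcoef : (1 : ℝ) ≤ (if (c : ℝ) - 1 < μ i then (1 : ℝ) else 0) +
        (if (c : ℝ) - 1 < -μ i then (1 : ℝ) else 0) := by
      rcases abs_choice (μ i) with h | h
      · rw [if_pos (by rw [← h]; linarith)]
        split_ifs <;> norm_num
      · rw [if_pos (show (c : ℝ) - 1 < -μ i by rw [← h]; linarith)]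
        split_ifs <;> norm_num
    have hpw : μ i ^ r ≤ (c : ℝ) ^ r := by
      rw [← hr.pow_abs]
      exact pow_le_pow_left₀ (abs_nonneg _) hle r
    have : (0 : ℝ) ≤ (c : ℝ) ^ r := by positivity
    nlinarith
  calc ∑ i, μ i ^ r ≤ _ := Finset.sum_le_sum fun i _ => hterm i
    _ = ∑ j ∈ Finset.range N, (((Finset.univ.filter (fun i => (N : ℝ) - 1 - j < μ i)).card : ℝ) +
        ((Finset.univ.filter (fun i => (N : ℝ) - 1 - j < -μ i)).card : ℝ)) * ((N : ℝ) - j) ^ r := by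
        rw [Finset.sum_comm]
        refine Finset.sum_congr rfl fun j _ => ?_
        rw [← Finset.sum_mul, Finset.sum_add_distrib]
        simp
    _ ≤ ∑ j ∈ Finset.range N, (D j + D j) * ((N : ℝ) - j) ^ r := by
        refine Finset.sum_le_sum fun j hj => ?_
        have hj' := Finset.mem_range.mp hj
        exact mul_le_mul_of_nonneg_right (add_le_add (h1 j hj') (h2 j hj')) (hr.pow_nonneg _)
    _ = _ := by
        rw [Finset.mul_sum]
        refine Finset.sum_congr rfl fun j _ => ?_
        ring

lemma starM_trace_le (N : ℕ) (r : ℕ) (hr : Even r) (hr0 : r ≠ 0) :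
    ((starM N) ^ r).trace ≤
      2 * ∑ j ∈ Finset.range N, (((N + 1).choose j * (N + 1) ^ j : ℕ) : ℝ) * ((N : ℝ) - j) ^ r := by
  obtain ⟨μ, v, hv, hμ, htr⟩ := exists_spectral (starM N) (starM_herm N)
  rw [htr]
  have heig : ∀ i x, ∑ k : Fin N, v i (x * star' k) = μ i * v i x := by
    intro i x
    rw [← starM_mulVec, hμ]; rfl
  apply sum_pow_bound N μ _ _ _ _ r hr hr0
  · intro i
    obtain ⟨x, -, hx⟩ := Finset.exists_max_image Finset.univ (fun x => |v i x|) ⟨1, Finset.mem_univ _⟩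
    have hvx : 0 < |v i x| := by
      by_contra h
      apply hv.ne_zero i
      funext y
      have := hx y (Finset.mem_univ _)
      have h3 : |v i y| ≤ 0 := this.trans (not_lt.mp h)
      exact abs_nonpos_iff.mp h3
    have : |μ i| * |v i x| ≤ N * |v i x| := by
      rw [← abs_mul, ← heig]
      refine (Finset.abs_sum_le_sum_abs _ _).trans ?_
      refine (Finset.sum_le_sum fun k _ => hx _ (Finset.mem_univ _)).trans ?_
      simp
    exact le_of_mul_le_mul_right this hvx
  · intro j hj
    refine le_trans ?_ (Nat.cast_le.mpr (Flev_finrank (N + 1) j))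
    refine Nat.cast_le.mpr (count_le v hv LinearMap.id Function.injective_id _ _ ?_)
    intro i hi
    exact eig_mem j (by omega) (μ i) (by simpa using hi) _ (heig i)
  · intro j hj
    refine le_trans ?_ (Nat.cast_le.mpr (Flev_finrank (N + 1) j))
    let sg : Equiv.Perm (Fin (N + 1)) → ℝ := fun x => ((Equiv.Perm.sign x : ℤ) : ℝ)
    have hsg : ∀ x, sg x * sg x = 1 := by
      intro x
      rcases Int.units_eq_one_or (Equiv.Perm.sign x) with h | h <;> simp [sg, h]
    have hsgm : ∀ x (k : Fin N), sg (x * star' k) = - sg x := by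
      intro x k
      have : Equiv.Perm.sign (star' k) = -1 :=
        Equiv.Perm.sign_swap (Fin.castSucc_lt_last k).ne
      simp [sg, this]
    let Φ : (Equiv.Perm (Fin (N + 1)) → ℝ) →ₗ[ℝ] (Equiv.Perm (Fin (N + 1)) → ℝ) :=
      LinearMap.mulLeft ℝ sg
    have hΦ : Function.Injective Φ := by
      intro f g hfg
      funext x
      have := congrFun hfg x
      simp only [Φ, LinearMap.mulLeft_apply, Pi.mul_apply] at this
      have h2 := congrArg (fun t => sg x * t) this
      simpa only [← mul_assoc, hsg, one_mul] using h2
    refine Nat.cast_le.mpr (count_le v hv Φ hΦ _ _ ?_)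
    intro i hi
    refine eig_mem j (by omega) (-μ i) (by simpa using hi) _ ?_
    intro x
    simp only [Φ, LinearMap.mulLeft_apply, Pi.mul_apply, hsgm]
    rw [← Finset.mul_sum, heig]
    ring

lemma starM_pow_inv (N r : ℕ) (g x y : Equiv.Perm (Fin (N + 1))) :
    (starM N ^ r) (g * x) (g * y) = (starM N ^ r) x y := by
  induction r generalizing x y with
  | zero => simp [Matrix.one_apply]
  | succ r ih =>
    rw [pow_succ, Matrix.mul_apply, Matrix.mul_apply, ← Equiv.sum_comp (Equiv.mulLeft g)]
    refine Finset.sum_congr rfl fun z _ => ?_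
    simp only [Equiv.coe_mulLeft, ih]
    congr 1
    simp [starM, mul_assoc]

lemma starM_trace (N r : ℕ) :
    (starM N ^ r).trace = ((N + 1).factorial : ℝ) * (starM N ^ r) 1 1 := by
  have : ∀ x, (starM N ^ r) x x = (starM N ^ r) 1 1 := by
    intro x
    have := starM_pow_inv N r x 1 1
    simpa using this
  simp [Matrix.trace, this, Fintype.card_perm]

lemma starM_sq (N r : ℕ) :
    ∑ x, ((starM N ^ r) 1 x) ^ 2 = (starM N ^ (2 * r)) 1 1 := by
  rw [two_mul, pow_add, Matrix.mul_apply]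
  refine Finset.sum_congr rfl fun x _ => ?_
  have h : (starM N ^ r).IsHermitian := (starM_herm N).pow r
  have h2 := h.apply 1 x
  simp only [star_trivial] at h2
  rw [h2, sq]

/-! Part 4: the walk driven by `P'`. -/

lemma star'_mul_star'_threeCycle {N : ℕ} {i j : Fin N} (hij : i ≠ j) :
    (star' i * star' j).IsThreeCycle := by
  have h := Equiv.Perm.isThreeCycle_swap_mul_swap_same
    (a := Fin.last N) (b := i.castSucc) (c := j.castSucc)
    (Fin.castSucc_lt_last i).ne' (Fin.castSucc_lt_last j).ne'
    (fun h => hij (Fin.castSucc_injective _ h))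
  rw [Equiv.swap_comm, Equiv.swap_comm (Fin.last N) j.castSucc] at h
  exact h

lemma star'_mul_star'_last {N : ℕ} {i j : Fin N} (hij : i ≠ j) :
    (star' i * star' j) (Fin.last N) = j.castSucc := by
  rw [Equiv.Perm.mul_apply, star', star', Equiv.swap_apply_right,
    Equiv.swap_apply_of_ne_of_ne (fun h => hij (Fin.castSucc_injective _ h).symm)
      (Fin.castSucc_lt_last j).ne]

lemma star'_mul_star'_j {N : ℕ} (i j : Fin N) :
    (star' i * star' j) j.castSucc = i.castSucc := by
  rw [Equiv.Perm.mul_apply, star', star', Equiv.swap_apply_left, Equiv.swap_apply_right]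

lemma P'_key (N : ℕ) (hN : 1 ≤ N) (H : Equiv.Perm (Fin (N + 1)) → ℝ) :
    ∑ π : alternatingGroup (Fin (N + 1)), P'meas (N + 1) π * H π
      = (∑ i : Fin N, ∑ j : Fin N, H (star' i * star' j)) / (N : ℝ) ^ 2 := by
  have hN0 : (N : ℝ) ≠ 0 := by positivity
  let C : alternatingGroup (Fin (N + 1)) → Prop := fun π =>
    (π : Equiv.Perm (Fin (N + 1))).IsThreeCycle ∧
      (Fin.last N) ∈ (π : Equiv.Perm (Fin (N + 1))).support
  have h1 : ∀ π : alternatingGroup (Fin (N + 1)), P'meas (N + 1) π * H π =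
      (if π = 1 then H 1 / N else 0) + (if C π then H π / (N : ℝ) ^ 2 else 0) := by
    intro π
    have hC : ((π : Equiv.Perm (Fin (N + 1))).IsThreeCycle ∧
      (∀ x : Fin (N + 1), (x : ℕ) = N + 1 - 1 → x ∈ (π : Equiv.Perm (Fin (N + 1))).support)) ↔ C π := by
      constructor
      · rintro ⟨h, h'⟩; exact ⟨h, h' _ (by simp)⟩
      · rintro ⟨h, h'⟩
        refine ⟨h, fun x hx => ?_⟩
        have : x = Fin.last N := by ext; simpa using hx
        rw [this]; exact h'
    unfold P'meas
    simp only [hC]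
    by_cases hπ : π = 1
    · subst hπ
      have : ¬ C 1 := fun h => h.1.isCycle.ne_one rfl
      simp [this]
      ring
    · have hπ' : (π : Equiv.Perm (Fin (N + 1))) ≠ 1 := fun h => hπ (Subtype.ext h)
      by_cases hc : C π
      · simp [hπ, hc]; ring
      · simp [hπ, hc]
  rw [Finset.sum_congr rfl (fun π _ => h1 π), Finset.sum_add_distrib, Finset.sum_ite_eq']
  simp only [Finset.mem_univ, if_true]
  rw [← Finset.sum_filter]
  have h2 : ∑ i : Fin N, ∑ j : Fin N, H (star' i * star' j) =
      N * H 1 + ∑ p ∈ (Finset.univ : Finset (Fin N × Fin N)).filter (fun p => p.1 ≠ p.2),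
        H (star' p.1 * star' p.2) := by
    rw [← Fintype.sum_prod_type',
      ← Finset.sum_filter_add_sum_filter_not Finset.univ (fun p : Fin N × Fin N => p.1 = p.2)]
    congr 1
    rw [Finset.sum_congr rfl (g := fun _ => H 1)]
    · rw [Finset.sum_const, nsmul_eq_mul]
      congr 2
      have : (Finset.univ : Finset (Fin N × Fin N)).filter (fun p => p.1 = p.2)
        = Finset.univ.image (fun i : Fin N => (i, i)) := by
        ext ⟨a, b⟩; simp
      rw [this, Finset.card_image_of_injective _ (fun a b h => (Prod.mk.inj h).1)]
      simp
    · rintro ⟨a, b⟩ hp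
      have : a = b := by simpa using hp
      subst this
      simp [star'_mul_self]
  rw [h2, add_div]
  congr 1
  · field_simp
  rw [Finset.sum_div]
  symm
  refine Finset.sum_bij (fun p hp => ⟨star' p.1 * star' p.2,
    (star'_mul_star'_threeCycle (by simpa using hp)).mem_alternatingGroup⟩) ?_ ?_ ?_ ?_
  · rintro ⟨i, j⟩ hp
    have hij : i ≠ j := by simpa using hp
    simp only [Finset.mem_filter, Finset.mem_univ, true_and]
    refine ⟨star'_mul_star'_threeCycle hij, ?_⟩
    rw [Equiv.Perm.mem_support, star'_mul_star'_last hij]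
    exact (Fin.castSucc_lt_last j).ne
  · rintro ⟨i, j⟩ hp ⟨i', j'⟩ hp' h
    have hij : i ≠ j := by simpa using hp
    have hij' : i' ≠ j' := by simpa using hp'
    have h' : star' i * star' j = star' i' * star' j' := congrArg Subtype.val h
    have e1 : j = j' := by
      have := congrArg (fun g : Equiv.Perm (Fin (N + 1)) => g (Fin.last N)) h'
      simp only [star'_mul_star'_last hij, star'_mul_star'_last hij'] at this
      exact Fin.castSucc_injective _ this
    subst e1
    have e2 : i = i' := by
      have := congrArg (fun g : Equiv.Perm (Fin (N + 1)) => g j.castSucc) h'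
      simp only [star'_mul_star'_j] at this
      exact Fin.castSucc_injective _ this
    rw [e2]
  · rintro ⟨g, hg⟩ hC
    simp only [Finset.mem_filter, Finset.mem_univ, true_and] at hC
    obtain ⟨h3, hl⟩ := hC
    change g.IsThreeCycle at h3
    change Fin.last N ∈ g.support at hl
    have hg3 : g (g (g (Fin.last N))) = Fin.last N := by
      have h : (g ^ 3) (Fin.last N) = Fin.last N := by
        rw [← h3.orderOf, pow_orderOf_eq_one]; rfl
      simpa [pow_succ] using h
    have hnd := (h3.nodup_iff_mem_support).mpr hl
    have ha : g (g (Fin.last N)) ∈ g.support := by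
      rw [Equiv.Perm.apply_mem_support, Equiv.Perm.apply_mem_support]; exact hl
    have hfac := (h3.eq_swap_mul_swap_iff_mem_support).mpr ha
    rw [hg3] at hfac
    have n1 : g (g (Fin.last N)) ≠ Fin.last N := by grind
    have n2 : g (Fin.last N) ≠ Fin.last N := by grind
    have n3 : g (g (Fin.last N)) ≠ g (Fin.last N) := by grind
    obtain ⟨i, hi⟩ := Fin.exists_castSucc_eq.mpr n1
    obtain ⟨j, hj⟩ := Fin.exists_castSucc_eq.mpr n2
    refine ⟨(i, j), ?_, ?_⟩
    · simp only [Finset.mem_filter, Finset.mem_univ, true_and]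
      intro h
      apply n3
      rw [← hi, ← hj, h]
    · apply Subtype.ext
      change star' i * star' j = g
      rw [star', star', hi, hj, Equiv.swap_comm (g (Fin.last N))]
      exact hfac.symm
  · rintro ⟨i, j⟩ hp
    rfl

lemma convPow_expect (N : ℕ) (hN : 1 ≤ N) (k : ℕ) (h : Equiv.Perm (Fin (N + 1)) → ℝ) :
    ∑ x : alternatingGroup (Fin (N + 1)), convPow (P'meas (N + 1)) k x * h x
      = ((starM N ^ (2 * k)).mulVec h) 1 / (N : ℝ) ^ (2 * k) := by
  induction k generalizing h with
  | zero => simp [convPow]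
  | succ k ih =>
    have h1 : ∑ x : alternatingGroup (Fin (N + 1)), convPow (P'meas (N + 1)) (k + 1) x * h x
      = ∑ g : alternatingGroup (Fin (N + 1)), convPow (P'meas (N + 1)) k g *
        (((starM N ^ 2).mulVec h) g / (N : ℝ) ^ 2) := by
      simp only [convPow, convolve, Finset.sum_mul]
      rw [Finset.sum_comm]
      refine Finset.sum_congr rfl fun g _ => ?_
      rw [← Equiv.sum_comp (Equiv.mulLeft g)]
      simp only [Equiv.coe_mulLeft, inv_mul_cancel_left, mul_assoc]
      rw [← Finset.mul_sum]
      congr 1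
      have := P'_key N hN (fun y => h (g * y))
      rw [pow_two (starM N), ← Matrix.mulVec_mulVec, starM_mulVec]
      simp only [starM_mulVec, mul_assoc]
      exact this
    have h2 := ih (fun g => ((starM N ^ 2).mulVec h) g / (N : ℝ) ^ 2)
    rw [h1, h2]
    have h3 : (fun g => ((starM N ^ 2).mulVec h) g / (N : ℝ) ^ 2)
        = ((N : ℝ) ^ 2)⁻¹ • ((starM N ^ 2).mulVec h) := by
      funext g; simp [div_eq_inv_mul]
    rw [h3, Matrix.mulVec_smul, Matrix.mulVec_mulVec, ← pow_add, Pi.smul_apply, smul_eq_mul]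
    rw [show 2 * (k + 1) = 2 * k + 2 by ring, pow_add (N : ℝ)]
    field_simp

lemma starM_pow_one (N r : ℕ) (x) : ((starM N ^ r).mulVec (fun _ => 1)) x = (N : ℝ) ^ r := by
  induction r generalizing x with
  | zero => simp
  | succ r ih =>
    rw [pow_succ', ← Matrix.mulVec_mulVec, starM_mulVec]
    simp only [ih]
    simp; ring

lemma convPow_mass (N : ℕ) (hN : 1 ≤ N) (k : ℕ) :
    ∑ x : alternatingGroup (Fin (N + 1)), convPow (P'meas (N + 1)) k x = 1 := by
  have h := convPow_expect N hN k (fun _ => 1)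
  rw [starM_pow_one, div_self (by positivity)] at h
  simpa using h

lemma convPow_eq (N : ℕ) (hN : 1 ≤ N) (k : ℕ) (x : alternatingGroup (Fin (N + 1))) :
    convPow (P'meas (N + 1)) k x = (starM N ^ (2 * k)) 1 x / (N : ℝ) ^ (2 * k) := by
  have h := convPow_expect N hN k (Pi.single (x : Equiv.Perm (Fin (N + 1))) 1)
  rw [Matrix.mulVec_single_one] at h
  rw [Finset.sum_eq_single x] at h
  · simpa using h
  · intro y _ hy
    rw [Pi.single_eq_of_ne (fun h => hy (Subtype.ext h)), mul_zero]
  · intro h; exact absurd (Finset.mem_univ _) h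

lemma convPow_nonneg (N : ℕ) (k : ℕ) (x : alternatingGroup (Fin (N + 1))) :
    0 ≤ convPow (P'meas (N + 1)) k x := by
  induction k generalizing x with
  | zero => simp only [convPow]; split_ifs <;> norm_num
  | succ k ih =>
    simp only [convPow, convolve]
    refine Finset.sum_nonneg fun g _ => mul_nonneg (ih g) ?_
    unfold P'meas
    have : (0 : ℝ) ≤ ((N + 1 : ℕ) : ℝ) - 1 := by push_cast; simp
    split_ifs <;> positivity

lemma unif_mass (N : ℕ) :
    ∑ x : alternatingGroup (Fin (N + 1)), unif (alternatingGroup (Fin (N + 1))) x = 1 := by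
  unfold unif
  rw [Finset.sum_const, Finset.card_univ, nsmul_eq_mul, mul_one_div_cancel]
  exact_mod_cast Fintype.card_ne_zero

lemma tv_nonneg {Ω : Type*} [Fintype Ω] (p q : Ω → ℝ) : 0 ≤ tvDist p q := by
  unfold tvDist; positivity

lemma tv_le_one (N : ℕ) (hN : 1 ≤ N) (k : ℕ) :
    tvDist (convPow (P'meas (N + 1)) k) (unif (alternatingGroup (Fin (N + 1)))) ≤ 1 := by
  unfold tvDist
  have : ∑ x : alternatingGroup (Fin (N + 1)),
      |convPow (P'meas (N + 1)) k x - unif (alternatingGroup (Fin (N + 1))) x| ≤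
      ∑ x : alternatingGroup (Fin (N + 1)),
      (convPow (P'meas (N + 1)) k x + unif (alternatingGroup (Fin (N + 1))) x) := by
    refine Finset.sum_le_sum fun x _ => ?_
    have h1 := convPow_nonneg N k x
    have h2 : 0 ≤ unif (alternatingGroup (Fin (N + 1))) x := by unfold unif; positivity
    rw [abs_le]; constructor <;> linarith
  rw [Finset.sum_add_distrib, convPow_mass N hN, unif_mass] at this
  linarith

lemma card_alt (N : ℕ) (hN : 1 ≤ N) :
    (Fintype.card (alternatingGroup (Fin (N + 1))) : ℝ) = ((N + 1).factorial : ℝ) / 2 := by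
  have : Nontrivial (Fin (N + 1)) := Fin.nontrivial_iff_two_le.mpr (by omega)
  have h := two_mul_card_alternatingGroup (α := Fin (N + 1))
  rw [Fintype.card_perm, Fintype.card_fin] at h
  rw [← h]; push_cast; ring

lemma tv_upper (N : ℕ) (hN : 1 ≤ N) (k : ℕ) (hk : k ≠ 0) :
    (2 * tvDist (convPow (P'meas (N + 1)) k) (unif (alternatingGroup (Fin (N + 1))))) ^ 2 ≤
      ∑ j ∈ Finset.Ico 1 N, (((N + 1).choose j * (N + 1) ^ j : ℕ) : ℝ) *
        (((N : ℝ) - j) / N) ^ (4 * k) := by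
  have hN0 : (0 : ℝ) < N := by exact_mod_cast hN
  set p := convPow (P'meas (N + 1)) k with hp
  set K : ℝ := (Fintype.card (alternatingGroup (Fin (N + 1))) : ℝ) with hK
  have hKpos : 0 < K := by rw [hK]; exact_mod_cast Fintype.card_pos
  have hmass : ∑ x, p x = 1 := convPow_mass N hN k
  have h1 : (2 * tvDist p (unif (alternatingGroup (Fin (N + 1))))) ^ 2 ≤
      K * ∑ x, (p x - 1 / K) ^ 2 := by
    have : 2 * tvDist p (unif (alternatingGroup (Fin (N + 1)))) = ∑ x, |p x - 1 / K| := by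
      unfold tvDist unif; ring
    rw [this]
    have := sq_sum_le_card_mul_sum_sq (s := (Finset.univ : Finset (alternatingGroup (Fin (N + 1)))))
      (f := fun x => |p x - 1 / K|)
    simp only [sq_abs, Finset.card_univ] at this
    exact this
  have h2 : K * ∑ x, (p x - 1 / K) ^ 2 = K * ∑ x, p x ^ 2 - 1 := by
    have : ∀ x, (p x - 1 / K) ^ 2 = p x ^ 2 - (2 / K) * p x + 1 / K ^ 2 := by
      intro x; ring
    simp only [this]
    rw [Finset.sum_add_distrib, Finset.sum_sub_distrib, ← Finset.mul_sum, hmass, Finset.sum_const,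
      Finset.card_univ, nsmul_eq_mul, ← hK]
    field_simp
    ring
  have h3 : ∑ x, p x ^ 2 ≤ (starM N ^ (4 * k)) 1 1 / (N : ℝ) ^ (4 * k) := by
    have e : ∀ x, p x ^ 2 = ((starM N ^ (2 * k)) 1 (x : Equiv.Perm (Fin (N + 1)))) ^ 2
        / (N : ℝ) ^ (4 * k) := by
      intro x
      rw [hp, convPow_eq N hN, div_pow, ← pow_mul]
      congr 2; ring
    simp only [e]
    rw [← Finset.sum_div]
    refine div_le_div_of_nonneg_right ?_ (by positivity)
    rw [show 4 * k = 2 * (2 * k) by ring, ← starM_sq]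
    have := Finset.sum_image (s := (Finset.univ : Finset (alternatingGroup (Fin (N + 1)))))
      (g := fun x => (x : Equiv.Perm (Fin (N + 1))))
      (f := fun x => ((starM N ^ (2 * k)) 1 x) ^ 2) (fun a _ b _ h => Subtype.ext h)
    rw [← this]
    exact Finset.sum_le_sum_of_subset_of_nonneg (Finset.subset_univ _) (fun _ _ _ => sq_nonneg _)
  have h4 := starM_trace_le N (4 * k) ⟨2 * k, by ring⟩ (by omega)
  rw [starM_trace] at h4
  have h5 : K * ((starM N ^ (4 * k)) 1 1 / (N : ℝ) ^ (4 * k)) ≤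
      ∑ j ∈ Finset.range N, (((N + 1).choose j * (N + 1) ^ j : ℕ) : ℝ) *
        (((N : ℝ) - j) / N) ^ (4 * k) := by
    rw [← mul_div_assoc, div_le_iff₀ (by positivity), Finset.sum_mul]
    have : ∀ j ∈ Finset.range N, (((N + 1).choose j * (N + 1) ^ j : ℕ) : ℝ) *
        (((N : ℝ) - j) / N) ^ (4 * k) * (N : ℝ) ^ (4 * k)
        = (((N + 1).choose j * (N + 1) ^ j : ℕ) : ℝ) * ((N : ℝ) - j) ^ (4 * k) := by
      intro j _
      rw [div_pow]; field_simp
    rw [Finset.sum_congr rfl this, hK, card_alt N hN]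
    linarith
  have h6 : ∑ j ∈ Finset.range N, (((N + 1).choose j * (N + 1) ^ j : ℕ) : ℝ) *
        (((N : ℝ) - j) / N) ^ (4 * k) = 1 + ∑ j ∈ Finset.Ico 1 N,
        (((N + 1).choose j * (N + 1) ^ j : ℕ) : ℝ) * (((N : ℝ) - j) / N) ^ (4 * k) := by
    rw [Finset.range_eq_Ico, Finset.sum_eq_sum_Ico_succ_bot (by omega)]
    simp [hN0.ne']
  have h7 := mul_le_mul_of_nonneg_left h3 hKpos.le
  linarith

lemma tv_upper' (N : ℕ) (hN : 1 ≤ N) (k : ℕ) (hk : k ≠ 0) (c : ℝ) (hc : 0 ≤ c)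
    (hkc : (1 / 2) * (N : ℝ) * Real.log ((N + 1 : ℕ) : ℝ) + c * ((N + 1 : ℕ) : ℝ) ≤ k) :
    tvDist (convPow (P'meas (N + 1)) k) (unif (alternatingGroup (Fin (N + 1)))) ≤
      Real.sqrt (Real.exp (Real.exp (-4 * c)) - 1) / 2 := by
  have hN0 : (0 : ℝ) < N := by exact_mod_cast hN
  have hn0 : (0 : ℝ) < ((N + 1 : ℕ) : ℝ) := by positivity
  set n : ℝ := ((N + 1 : ℕ) : ℝ) with hn
  have hterm : ∀ j ∈ Finset.Ico 1 N, (((N + 1).choose j * (N + 1) ^ j : ℕ) : ℝ) *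
        (((N : ℝ) - j) / N) ^ (4 * k) ≤ (Real.exp (-4 * c)) ^ j / (j.factorial : ℝ) := by
    intro j hj
    have hjN : (j : ℝ) ≤ N := by exact_mod_cast (Finset.mem_Ico.mp hj).2.le
    have e1 : ((N : ℝ) - j) / N ≤ Real.exp (-(j / N)) := by
      have := Real.add_one_le_exp (-((j : ℝ) / N))
      have e : ((N : ℝ) - j) / N = -((j : ℝ) / N) + 1 := by field_simp; ring
      rw [e]; exact this
    have e2 : (((N : ℝ) - j) / N) ^ (4 * k) ≤ Real.exp (-(j / N)) ^ (4 * k) :=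
      pow_le_pow_left₀ (div_nonneg (by linarith) hN0.le) e1 _
    have e3 : Real.exp (-(j / N)) ^ (4 * k) ≤ (n ^ (2 * j))⁻¹ * (Real.exp (-4 * c)) ^ j := by
      have : (n ^ (2 * j))⁻¹ = Real.exp (-(2 * j * Real.log n)) := by
        rw [Real.exp_neg, ← Real.exp_log (pow_pos hn0 (2 * j)), Real.log_pow]
        push_cast; rfl
      rw [this, ← Real.exp_nat_mul, ← Real.exp_nat_mul, ← Real.exp_add]
      apply Real.exp_le_exp.mpr
      have h1 : (2 : ℝ) * Real.log n + 4 * c ≤ 4 * k / N := by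
        rw [le_div_iff₀ hN0]
        have : c * N ≤ c * n := mul_le_mul_of_nonneg_left (by rw [hn]; push_cast; linarith) hc
        nlinarith
      have h2 := mul_le_mul_of_nonneg_left h1 (Nat.cast_nonneg (α := ℝ) j)
      push_cast
      have h3 : (4 : ℝ) * k * (-(j / N)) = -(j * (4 * k / N)) := by ring
      rw [h3]
      linarith
    have e4 : (((N + 1).choose j * (N + 1) ^ j : ℕ) : ℝ) ≤ n ^ (2 * j) / (j.factorial : ℝ) := by
      have := Nat.choose_le_pow_div (α := ℝ) j (N + 1)
      rw [Nat.cast_mul, Nat.cast_pow, ← hn]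
      calc _ ≤ n ^ j / (j.factorial : ℝ) * n ^ j := by
            exact mul_le_mul_of_nonneg_right this (by positivity)
        _ = _ := by rw [two_mul, pow_add]; ring
    calc _ ≤ n ^ (2 * j) / (j.factorial : ℝ) * ((n ^ (2 * j))⁻¹ * (Real.exp (-4 * c)) ^ j) :=
          mul_le_mul e4 (e2.trans e3) (pow_nonneg (div_nonneg (by linarith) hN0.le) _)
            (by positivity)
      _ = _ := by field_simp
  have h1 := (tv_upper N hN k hk).trans (Finset.sum_le_sum hterm)
  have h2 := Real.sum_le_exp_of_nonneg (x := Real.exp (-4 * c)) (Real.exp_pos _).le N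
  rw [Finset.range_eq_Ico, Finset.sum_eq_sum_Ico_succ_bot (by omega)] at h2
  simp only [pow_zero, Nat.factorial_zero, Nat.cast_one, div_one, zero_add] at h2
  have h3 := Real.le_sqrt_of_sq_le (h1.trans (show _ ≤ Real.exp (Real.exp (-4 * c)) - 1 by linarith))
  linarith

/-! Part 5: lower bound. -/

noncomputable def EE (N : ℕ) : ℕ → (Equiv.Perm (Fin (N + 1)) → Finset (Fin N) → ℝ) →
    Equiv.Perm (Fin (N + 1)) → Finset (Fin N) → ℝ
  | 0, F => F
  | r + 1, F => fun x S => (∑ i : Fin N, EE N r F (x * star' i) (insert i S)) / N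

lemma EE_fst (N : ℕ) (r : ℕ) (h : Equiv.Perm (Fin (N + 1)) → ℝ) (x S) :
    EE N r (fun x _ => h x) x S = ((starM N ^ r).mulVec h) x / (N : ℝ) ^ r := by
  induction r generalizing x S with
  | zero => simp [EE]
  | succ r ih =>
    simp only [EE, ih]
    rw [pow_succ' (starM N), ← Matrix.mulVec_mulVec, starM_mulVec, ← Finset.sum_div, pow_succ,
      div_div]

lemma EE_mono (N : ℕ) (r : ℕ) (F F' : Equiv.Perm (Fin (N + 1)) → Finset (Fin N) → ℝ)
    (hF : ∀ x S, (∀ i, i ∉ S → x i.castSucc = i.castSucc) → F x S ≤ F' x S) :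
    ∀ x S, (∀ i, i ∉ S → x i.castSucc = i.castSucc) → EE N r F x S ≤ EE N r F' x S := by
  induction r with
  | zero => exact hF
  | succ r ih =>
    intro x S hx
    simp only [EE]
    refine div_le_div_of_nonneg_right (Finset.sum_le_sum fun k _ => ?_) (by positivity)
    apply ih
    intro i hi
    simp only [Finset.mem_insert, not_or] at hi
    rw [Equiv.Perm.mul_apply, star', Equiv.swap_apply_of_ne_of_ne, hx i hi.2]
    · exact fun h => hi.1 (Fin.castSucc_injective _ h)
    · exact (Fin.castSucc_lt_last i).ne

lemma sum_insert_card (N : ℕ) (S : Finset (Fin N)) (g : ℝ → ℝ) :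
    ∑ k : Fin N, g ((insert k S).card : ℝ)
      = S.card * g S.card + ((N : ℝ) - S.card) * g (S.card + 1) := by
  have : ∀ k : Fin N, g ((insert k S).card : ℝ)
      = if k ∈ S then g S.card else g (S.card + 1) := by
    intro k
    split_ifs with h
    · rw [Finset.insert_eq_of_mem h]
    · rw [Finset.card_insert_of_notMem h]; push_cast; rfl
  simp only [this]
  rw [Finset.sum_ite]
  have h1 : Finset.univ.filter (fun k => k ∈ S) = S := by ext; simp
  have h2 : Finset.univ.filter (fun k => k ∉ S) = Sᶜ := by ext; simp
  have h3 : S.card ≤ N := by simpa using Finset.card_le_univ S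
  rw [h1, h2, Finset.sum_const, Finset.sum_const, Finset.card_compl, Fintype.card_fin,
    nsmul_eq_mul, nsmul_eq_mul, Nat.cast_sub h3]

lemma EE_poly (N : ℕ) (hN : 1 ≤ N) (r : ℕ) (α β γ : ℝ) (x S) :
    EE N r (fun _ S => α + β * ((N : ℝ) - S.card)
        + γ * (((N : ℝ) - S.card) * ((N : ℝ) - S.card - 1))) x S
      = α + β * (1 - 1 / N) ^ r * ((N : ℝ) - S.card)
        + γ * (1 - 2 / N) ^ r * (((N : ℝ) - S.card) * ((N : ℝ) - S.card - 1)) := by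
  have hN0 : (N : ℝ) ≠ 0 := by positivity
  induction r generalizing x S with
  | zero => simp [EE]
  | succ r ih =>
    simp only [EE, ih]
    rw [sum_insert_card N S (fun t => α + β * (1 - 1 / N) ^ r * ((N : ℝ) - t)
        + γ * (1 - 2 / N) ^ r * (((N : ℝ) - t) * ((N : ℝ) - t - 1)))]
    rw [pow_succ, pow_succ]
    generalize (1 - 1 / (N : ℝ)) ^ r = A
    generalize (1 - 2 / (N : ℝ)) ^ r = B
    field_simp
    ring

noncomputable def fixc {n : ℕ} (x : Equiv.Perm (Fin n)) : ℕ :=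
  (Finset.univ.filter (fun i => x i = i)).card

lemma sum_fixc (N : ℕ) (hN : 2 ≤ N) :
    ∑ x : alternatingGroup (Fin (N + 1)), fixc (x : Equiv.Perm (Fin (N + 1)))
      = Fintype.card (alternatingGroup (Fin (N + 1))) := by
  have htr : MulAction.IsPretransitive (alternatingGroup (Fin (N + 1))) (Fin (N + 1)) :=
    alternatingGroup.isPretransitive_of_three_le_card _ (by simp; omega)
  have h := MulAction.sum_card_fixedBy_eq_card_orbits_mul_card_group
    (alternatingGroup (Fin (N + 1))) (Fin (N + 1))
  have h1 : Fintype.card (MulAction.orbitRel.Quotient (alternatingGroup (Fin (N + 1)))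
      (Fin (N + 1))) = 1 := by
    have : Subsingleton (MulAction.orbitRel.Quotient (alternatingGroup (Fin (N + 1)))
      (Fin (N + 1))) := (MulAction.pretransitive_iff_subsingleton_quotient _ _).mp htr
    rw [Fintype.card_eq_one_iff]
    exact ⟨Quotient.mk'' 0, fun y => Subsingleton.elim _ _⟩
  rw [h1, one_mul] at h
  rw [← h]
  refine Finset.sum_congr rfl fun x _ => ?_
  unfold fixc
  rw [Fintype.card_ofFinset]
  rfl

lemma tv_lower (N : ℕ) (hN : 2 ≤ N) (k : ℕ) (M : ℝ) (hM : M = N * (1 - 1 / (N : ℝ)) ^ (2 * k)) :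
    1 - 6 / M ≤ tvDist (convPow (P'meas (N + 1)) k) (unif (alternatingGroup (Fin (N + 1)))) := by
  have hN1 : 1 ≤ N := by omega
  have hN2 : (2 : ℝ) ≤ N := by exact_mod_cast hN
  have hN0 : (0 : ℝ) < N := by linarith
  have hq : (0 : ℝ) < 1 - 1 / N := by
    rw [sub_pos, div_lt_one hN0]; linarith
  have hM0 : 0 < M := by rw [hM]; positivity
  let h : Equiv.Perm (Fin (N + 1)) → ℝ := fun x => if M / 2 < (fixc x : ℝ) then 1 else 0
  set p := convPow (P'meas (N + 1)) k with hp
  set u := unif (alternatingGroup (Fin (N + 1))) with hu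
  -- probability under the walk
  have hpB : 1 - 4 / M ≤ ∑ x, p x * h x := by
    rw [hp, convPow_expect N hN1, ← EE_fst N (2 * k) h 1 ∅]
    have hmono := EE_mono N (2 * k)
      (fun _ S => (1 - 4) + ((4 / M ^ 2) * (2 * M - 1)) * ((N : ℝ) - S.card)
        + (-(4 / M ^ 2)) * (((N : ℝ) - S.card) * ((N : ℝ) - S.card - 1)))
      (fun x _ => h x) (by
        intro x S hx
        have e : (1 - 4) + ((4 / M ^ 2) * (2 * M - 1)) * ((N : ℝ) - S.card)
          + (-(4 / M ^ 2)) * (((N : ℝ) - S.card) * ((N : ℝ) - S.card - 1))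
          = 1 - (4 / M ^ 2) * (((N : ℝ) - S.card) - M) ^ 2 := by
          field_simp; ring
        simp only [e]
        have hfix : (N : ℝ) - S.card ≤ fixc x := by
          have h3 : S.card ≤ N := by simpa using Finset.card_le_univ S
          have : N - S.card ≤ fixc x := by
            have hc : N - S.card = (Sᶜ.map Fin.castSuccEmb).card := by
              rw [Finset.card_map, Finset.card_compl, Fintype.card_fin]
            rw [hc]
            apply Finset.card_le_card
            intro i hi
            obtain ⟨a, ha, rfl⟩ := Finset.mem_map.mp hi
            simpa using hx a (by simpa using ha)
          rw [← Nat.cast_sub h3]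
          exact_mod_cast this
        simp only [h]
        split_ifs with hc
        · have : 0 ≤ (4 / M ^ 2) * (((N : ℝ) - S.card) - M) ^ 2 := by positivity
          linarith
        · push Not at hc
          have h5 : M / 2 ≤ M - ((N : ℝ) - S.card) := by linarith
          have h6 : (M / 2) ^ 2 ≤ (((N : ℝ) - S.card) - M) ^ 2 := by nlinarith
          have h7 := mul_le_mul_of_nonneg_left h6 (show 0 ≤ 4 / M ^ 2 by positivity)
          have h8 : 4 / M ^ 2 * (M / 2) ^ 2 = 1 := by field_simp; norm_num
          linarith) 1 ∅ (fun _ _ => rfl)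
    rw [EE_poly N hN1] at hmono
    refine le_trans ?_ hmono
    simp only [Finset.card_empty, Nat.cast_zero, sub_zero]
    have hq2 : 0 ≤ 1 - 2 / (N : ℝ) := by rw [sub_nonneg, div_le_one hN0]; exact hN2
    have hq12 : (1 - 2 / (N : ℝ)) ^ (2 * k) ≤ ((1 - 1 / (N : ℝ)) ^ (2 * k)) ^ 2 := by
      have hsw : ((1 - 1 / (N : ℝ)) ^ (2 * k)) ^ 2 = ((1 - 1 / (N : ℝ)) ^ 2) ^ (2 * k) := by
        rw [← pow_mul, ← pow_mul, mul_comm]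
      rw [hsw]
      apply pow_le_pow_left₀ hq2
      have : (1 - 1 / (N : ℝ)) ^ 2 = 1 - 2 / N + (1 / N) ^ 2 := by ring
      rw [this]
      have : 0 ≤ (1 / (N : ℝ)) ^ 2 := by positivity
      linarith
    have hB0 : 0 ≤ (1 - 2 / (N : ℝ)) ^ (2 * k) := pow_nonneg hq2 _
    have hkey : (1 - 2 / (N : ℝ)) ^ (2 * k) * ((N : ℝ) * (N - 1)) ≤ M ^ 2 := by
      have e : M ^ 2 = ((1 - 1 / (N : ℝ)) ^ (2 * k)) ^ 2 * (N : ℝ) ^ 2 := by rw [hM]; ring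
      rw [e]
      apply mul_le_mul hq12 (by nlinarith) (by nlinarith) (by positivity)
    have e1 : 4 / M ^ 2 * (2 * M - 1) * (1 - 1 / (N : ℝ)) ^ (2 * k) * N = 8 - 4 / M := by
      have : 4 / M ^ 2 * (2 * M - 1) * (1 - 1 / (N : ℝ)) ^ (2 * k) * N
        = 4 / M ^ 2 * (2 * M - 1) * (N * (1 - 1 / (N : ℝ)) ^ (2 * k)) := by ring
      rw [this, ← hM]
      field_simp
      ring
    have e2 : 4 / M ^ 2 * ((1 - 2 / (N : ℝ)) ^ (2 * k) * ((N : ℝ) * (N - 1))) ≤ 4 := by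
      calc _ ≤ 4 / M ^ 2 * M ^ 2 := mul_le_mul_of_nonneg_left hkey (by positivity)
        _ = 4 := by field_simp
    have e3 : -(4 / M ^ 2) * (1 - 2 / (N : ℝ)) ^ (2 * k) * ((N : ℝ) * (N - 1))
      = -(4 / M ^ 2 * ((1 - 2 / (N : ℝ)) ^ (2 * k) * ((N : ℝ) * (N - 1)))) := by ring
    rw [e1, e3]
    linarith
  -- probability under uniform
  have huB : ∑ x : alternatingGroup (Fin (N + 1)), u x * h x ≤ 2 / M := by
    have h1 : ∀ x : alternatingGroup (Fin (N + 1)), u x * h x ≤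
        (2 / M) * (1 / (Fintype.card (alternatingGroup (Fin (N + 1))) : ℝ))
          * (fixc (x : Equiv.Perm (Fin (N + 1))) : ℝ) := by
      intro x
      have hu' : u x = 1 / (Fintype.card (alternatingGroup (Fin (N + 1))) : ℝ) := rfl
      rw [← hu']
      have hux : 0 ≤ u x := by rw [hu']; positivity
      have : h x ≤ (2 / M) * fixc (x : Equiv.Perm (Fin (N + 1))) := by
        simp only [h]
        split_ifs with hc
        · rw [div_mul_eq_mul_div, le_div_iff₀ hM0]; linarith
        · positivity
      calc u x * h x ≤ u x * ((2 / M) * fixc (x : Equiv.Perm (Fin (N + 1)))) :=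
            mul_le_mul_of_nonneg_left this hux
        _ = _ := by ring
    refine (Finset.sum_le_sum fun x _ => h1 x).trans ?_
    rw [← Finset.mul_sum, ← Nat.cast_sum, sum_fixc N hN]
    have : (Fintype.card (alternatingGroup (Fin (N + 1))) : ℝ) ≠ 0 := by
      exact_mod_cast Fintype.card_ne_zero
    rw [mul_assoc, one_div_mul_cancel this, mul_one]
  -- conclusion
  have hpm : ∑ x, p x = 1 := convPow_mass N hN1 k
  have hum : ∑ x, u x = 1 := unif_mass N
  have habs : ∑ x : alternatingGroup (Fin (N + 1)), (p x - u x) * (2 * h x - 1) ≤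
      ∑ x, |p x - u x| := by
    refine Finset.sum_le_sum fun x _ => ?_
    simp only [h]
    have ha := le_abs_self (p x - u x)
    have hb := neg_abs_le (p x - u x)
    split_ifs <;> linarith
  have hexp : ∑ x : alternatingGroup (Fin (N + 1)), (p x - u x) * (2 * h x - 1)
      = 2 * (∑ x, p x * h x) - 2 * (∑ x, u x * h x) - ∑ x, p x + ∑ x, u x := by
    rw [Finset.mul_sum, Finset.mul_sum, ← Finset.sum_sub_distrib, ← Finset.sum_sub_distrib,
      ← Finset.sum_add_distrib]
    refine Finset.sum_congr rfl fun x _ => ?_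
    ring
  unfold tvDist
  have : 6 / M = 4 / M + 2 / M := by ring
  rw [hexp, hpm, hum] at habs
  linarith

lemma tv_lower' (N : ℕ) (hN : 2 ≤ N) (k : ℕ) (c : ℝ) (hc : c ≤ 0)
    (hlog : Real.log ((N + 1 : ℕ) : ℝ) + 2 ≤ (N : ℝ) - 1)
    (hk : (k : ℝ) ≤ (1 / 2) * (N : ℝ) * Real.log ((N + 1 : ℕ) : ℝ) + c * ((N + 1 : ℕ) : ℝ) + 1) :
    1 - 12 * Real.exp (1 + 2 * c) ≤
      tvDist (convPow (P'meas (N + 1)) k) (unif (alternatingGroup (Fin (N + 1)))) := by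
  have hN2 : (2 : ℝ) ≤ N := by exact_mod_cast hN
  have hN0 : (0 : ℝ) < N := by linarith
  have hN1 : (0 : ℝ) < (N : ℝ) - 1 := by linarith
  have hcast : ((N + 1 : ℕ) : ℝ) = (N : ℝ) + 1 := by push_cast; ring
  rw [hcast] at hlog hk
  set L := Real.log ((N : ℝ) + 1) with hL
  have h1 : Real.exp (-(1 / ((N : ℝ) - 1))) ≤ 1 - 1 / N := by
    have h := Real.add_one_le_exp (1 / ((N : ℝ) - 1))
    have e : 1 / ((N : ℝ) - 1) + 1 = N / (N - 1) := by field_simp; ring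
    rw [e] at h
    rw [Real.exp_neg]
    have e2 : 1 - 1 / (N : ℝ) = (N / ((N : ℝ) - 1))⁻¹ := by field_simp
    rw [e2]
    exact inv_anti₀ (by positivity) h
  have h2 : Real.exp (-(L + 1 + 2 * c)) ≤ (1 - 1 / (N : ℝ)) ^ (2 * k) := by
    calc Real.exp (-(L + 1 + 2 * c)) ≤ Real.exp (-(1 / ((N : ℝ) - 1))) ^ (2 * k) := by
          rw [← Real.exp_nat_mul]
          apply Real.exp_le_exp.mpr
          have : (2 * k : ℝ) / (N - 1) ≤ L + 1 + 2 * c := by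
            rw [div_le_iff₀ hN1]
            nlinarith
          push_cast
          have e : (2 : ℝ) * k * -(1 / ((N : ℝ) - 1)) = -((2 * k : ℝ) / (N - 1)) := by ring
          rw [e]; linarith
      _ ≤ _ := pow_le_pow_left₀ (Real.exp_pos _).le h1 _
  have hML : Real.exp (-(1 + 2 * c)) / 2 ≤ N * (1 - 1 / (N : ℝ)) ^ (2 * k) := by
    have e : Real.exp (-(L + 1 + 2 * c)) = Real.exp (-(1 + 2 * c)) / (N + 1) := by
      rw [show -(L + 1 + 2 * c) = -(1 + 2 * c) - L by ring, Real.exp_sub, hL,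
        Real.exp_log (by linarith)]
    rw [e] at h2
    calc Real.exp (-(1 + 2 * c)) / 2 ≤ N * (Real.exp (-(1 + 2 * c)) / (N + 1)) := by
          rw [← mul_div_assoc, div_le_div_iff₀ (by norm_num) (by linarith)]
          have := Real.exp_pos (-(1 + 2 * c))
          nlinarith
      _ ≤ _ := mul_le_mul_of_nonneg_left h2 hN0.le
  have h3 := tv_lower N hN k _ rfl
  refine le_trans ?_ h3
  have h4 : 6 / (N * (1 - 1 / (N : ℝ)) ^ (2 * k)) ≤ 6 / (Real.exp (-(1 + 2 * c)) / 2) :=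
    div_le_div_of_nonneg_left (by norm_num) (by positivity) hML
  have h5 : 6 / (Real.exp (-(1 + 2 * c)) / 2) = 12 * Real.exp (1 + 2 * c) := by
    rw [Real.exp_neg]
    field_simp; norm_num
  linarith

/-! Part 6: conclusion. -/

lemma ev_upper (c : ℝ) (hc : 0 ≤ c) : ∀ᶠ n : ℕ in atTop,
    tvDist (convPow (P'meas n) ⌈(1 / 2) * ((n : ℝ) - 1) * Real.log n + c * n⌉₊)
      (unif (alternatingGroup (Fin n))) ≤ Real.sqrt (Real.exp (Real.exp (-4 * c)) - 1) / 2 := by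
  filter_upwards [eventually_ge_atTop 2] with n hn
  obtain ⟨N, rfl⟩ : ∃ N, n = N + 1 := ⟨n - 1, by omega⟩
  have e : (((N + 1 : ℕ) : ℝ) - 1) = N := by push_cast; ring
  rw [e]
  have hN : 1 ≤ N := by omega
  have hN0 : (0 : ℝ) < N := by exact_mod_cast hN
  have hlog : 0 < Real.log ((N + 1 : ℕ) : ℝ) := Real.log_pos (by push_cast; linarith)
  apply tv_upper' N hN _ _ c hc (Nat.le_ceil _)
  have : 0 < (1 / 2) * (N : ℝ) * Real.log ((N + 1 : ℕ) : ℝ) + c * ((N + 1 : ℕ) : ℝ) := by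
    have : 0 ≤ c * ((N + 1 : ℕ) : ℝ) := by positivity
    positivity
  exact (Nat.ceil_pos.mpr this).ne'

lemma ev_le_one (c : ℝ) : ∀ᶠ n : ℕ in atTop,
    tvDist (convPow (P'meas n) ⌈(1 / 2) * ((n : ℝ) - 1) * Real.log n + c * n⌉₊)
      (unif (alternatingGroup (Fin n))) ≤ 1 := by
  filter_upwards [eventually_ge_atTop 2] with n hn
  obtain ⟨N, rfl⟩ : ∃ N, n = N + 1 := ⟨n - 1, by omega⟩
  exact tv_le_one N (by omega) _

lemma ev_lower (c : ℝ) (hc : c ≤ 0) : ∀ᶠ n : ℕ in atTop,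
    1 - 12 * Real.exp (1 + 2 * c) ≤
    tvDist (convPow (P'meas n) ⌈(1 / 2) * ((n : ℝ) - 1) * Real.log n + c * n⌉₊)
      (unif (alternatingGroup (Fin n))) := by
  have hl : Tendsto (fun n : ℕ => Real.log n) atTop atTop :=
    Real.tendsto_log_atTop.comp tendsto_natCast_atTop_atTop
  have hlo : ∀ᶠ n : ℕ in atTop, Real.log n ≤ (1 / 2) * (n : ℝ) := by
    have h := Real.isLittleO_log_id_atTop.bound (show (0 : ℝ) < 1 / 2 by norm_num)
    have h2 := tendsto_natCast_atTop_atTop (R := ℝ).eventually h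
    filter_upwards [h2] with n hn
    simp only [id, Real.norm_eq_abs, Nat.abs_cast] at hn
    exact (le_abs_self _).trans hn
  filter_upwards [eventually_ge_atTop 8, hlo, hl.eventually_ge_atTop (-4 * c)] with n hn h1 h2
  obtain ⟨N, rfl⟩ : ∃ N, n = N + 1 := ⟨n - 1, by omega⟩
  have e : (((N + 1 : ℕ) : ℝ) - 1) = N := by push_cast; ring
  rw [e]
  have hN8 : (8 : ℝ) ≤ ((N + 1 : ℕ) : ℝ) := by exact_mod_cast hn
  apply tv_lower' N (by omega) _ c hc
  · linarith
  · refine (Nat.ceil_lt_add_one ?_).le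
    nlinarith

theorem cutoff_P' :
    Filter.Tendsto (fun c : ℝ =>
        Filter.limsup (fun n : ℕ =>
          tvDist (convPow (P'meas n) ⌈(1 / 2) * ((n : ℝ) - 1) * Real.log n + c * n⌉₊)
            (unif (alternatingGroup (Fin n)))) Filter.atTop)
      Filter.atTop (nhds 0) ∧
    Filter.Tendsto (fun c : ℝ =>
        Filter.liminf (fun n : ℕ =>
          tvDist (convPow (P'meas n) ⌈(1 / 2) * ((n : ℝ) - 1) * Real.log n + c * n⌉₊)
            (unif (alternatingGroup (Fin n)))) Filter.atTop)
      Filter.atBot (nhds 1) := by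
  have hnn : ∀ c : ℝ, ∀ n : ℕ, 0 ≤
      tvDist (convPow (P'meas n) ⌈(1 / 2) * ((n : ℝ) - 1) * Real.log n + c * n⌉₊)
        (unif (alternatingGroup (Fin n))) := fun c n => tv_nonneg _ _
  have hbdd : ∀ c : ℝ, IsBoundedUnder (· ≤ ·) atTop (fun n : ℕ =>
      tvDist (convPow (P'meas n) ⌈(1 / 2) * ((n : ℝ) - 1) * Real.log n + c * n⌉₊)
        (unif (alternatingGroup (Fin n)))) := fun c => ⟨1, ev_le_one c⟩
  have hbdd' : ∀ c : ℝ, IsBoundedUnder (· ≥ ·) atTop (fun n : ℕ =>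
      tvDist (convPow (P'meas n) ⌈(1 / 2) * ((n : ℝ) - 1) * Real.log n + c * n⌉₊)
        (unif (alternatingGroup (Fin n)))) := fun c => isBoundedUnder_of ⟨0, hnn c⟩
  constructor
  · have hlim : Tendsto (fun c : ℝ => Real.sqrt (Real.exp (Real.exp (-4 * c)) - 1) / 2) atTop
        (nhds 0) := by
      have h1 : Tendsto (fun c : ℝ => Real.exp (-4 * c)) atTop (nhds 0) :=
        Real.tendsto_exp_atBot.comp (tendsto_id.const_mul_atTop_of_neg (by norm_num))
      have h2 : Continuous (fun t : ℝ => Real.sqrt (Real.exp t - 1) / 2) := by fun_prop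
      have h3 : Tendsto (fun c : ℝ => Real.sqrt (Real.exp (Real.exp (-4 * c)) - 1) / 2) atTop
          (nhds (Real.sqrt (Real.exp 0 - 1) / 2)) := (h2.tendsto 0).comp h1
      simpa using h3
    refine tendsto_of_tendsto_of_tendsto_of_le_of_le' tendsto_const_nhds hlim ?_ ?_
    · refine Eventually.of_forall fun c => ?_
      exact le_limsup_of_frequently_le (Frequently.of_forall (hnn c)) (hbdd c)
    · filter_upwards [eventually_ge_atTop 0] with c hc
      exact limsup_le_of_le (hbdd' c).isCoboundedUnder_le (ev_upper c hc)
  · have hlim : Tendsto (fun c : ℝ => 1 - 12 * Real.exp (1 + 2 * c)) atBot (nhds 1) := by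
      have h1 : Tendsto (fun c : ℝ => Real.exp (1 + 2 * c)) atBot (nhds 0) :=
        Real.tendsto_exp_atBot.comp
          (tendsto_atBot_add_const_left _ _ (tendsto_id.const_mul_atBot (by norm_num)))
      simpa using (h1.const_mul 12).const_sub 1
    refine tendsto_of_tendsto_of_tendsto_of_le_of_le' hlim tendsto_const_nhds ?_ ?_
    · filter_upwards [eventually_le_atBot 0] with c hc
      exact le_liminf_of_le (hbdd c).isCoboundedUnder_ge (ev_lower c hc)
    · refine Eventually.of_forall fun c => ?_
      exact liminf_le_of_frequently_le (ev_le_one c).frequently (hbdd' c)
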